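/- Let φ(x) = (2π)^(−1/2) exp(−x²/2) denote the standard normal density and Φ(x) = ∫_{−∞}^x φ(t) dt the standard normal CDF. Fix σ > 0 and thresholds a < b, and define h(x) = −log( Φ((b − x)/σ) − Φ((a − x)/σ) ). Then for every x ∈ ℝ the second derivative of h satisfies 0 ≤ h''(x) ≤ 1/σ². (Hessian bound for the per-entry Probit loss, combining its convexity with the bound on the truncated-Gaussian variance.) -/

import Mathlib

open MeasureTheory

/-- The standard normal density `φ(x) = (2π)^(−1/2) exp(−x²/2)`. -/
noncomputable def stdNormalPDF (x : ℝ) : ℝ :=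
  (Real.sqrt (2 * Real.pi))⁻¹ * Real.exp (-x ^ 2 / 2)

/-- The standard normal CDF `Φ(x) = ∫_{−∞}^x φ(t) dt`. -/
noncomputable def stdNormalCDF (x : ℝ) : ℝ :=
  ∫ t in Set.Iic x, stdNormalPDF t

theorem stdNormalPDF_pos (x : ℝ) : 0 < stdNormalPDF x := by
  unfold stdNormalPDF
  positivity

theorem continuous_stdNormalPDF : Continuous stdNormalPDF := by
  unfold stdNormalPDF
  fun_prop

theorem integrable_stdNormalPDF : Integrable stdNormalPDF := by
  have h := (integrable_exp_neg_mul_sq (b := 1 / 2) (by norm_num)).const_mul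
    (Real.sqrt (2 * Real.pi))⁻¹
  refine h.congr (ae_of_all _ fun x => ?_)
  simp only [stdNormalPDF]
  ring_nf

theorem hasDerivAt_stdNormalPDF (x : ℝ) :
    HasDerivAt stdNormalPDF (-x * stdNormalPDF x) x := by
  have h : HasDerivAt (fun y : ℝ => -y ^ 2 / 2) (-x) x := by
    refine (((hasDerivAt_id x).pow 2).neg.div_const 2).congr_deriv ?_
    simp
    ring
  refine (h.exp.const_mul (Real.sqrt (2 * Real.pi))⁻¹).congr_deriv ?_
  simp only [stdNormalPDF]
  ring

theorem hasDerivAt_stdNormalCDF (x : ℝ) : HasDerivAt stdNormalCDF (stdNormalPDF x) x := by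
  have h : stdNormalCDF = fun y => (∫ t in (0 : ℝ)..y, stdNormalPDF t) + stdNormalCDF 0 := by
    ext y
    rw [← intervalIntegral.integral_Iic_sub_Iic integrable_stdNormalPDF.integrableOn
      integrable_stdNormalPDF.integrableOn]
    simp [stdNormalCDF]
  rw [h]
  exact (continuous_stdNormalPDF.integral_hasStrictDerivAt 0 x).hasDerivAt.add_const _

theorem strictMono_stdNormalCDF : StrictMono stdNormalCDF :=
  strictMono_of_hasDerivAt_pos hasDerivAt_stdNormalCDF stdNormalPDF_pos

/-- The mean of the standard normal law truncated to `[u, v]` lies in `(u, v)`. -/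
theorem exists_stdNormalPDF_sub_eq_mul {u v : ℝ} (huv : u < v) :
    ∃ m ∈ Set.Ioo u v,
      stdNormalPDF u - stdNormalPDF v = m * (stdNormalCDF v - stdNormalCDF u) := by
  obtain ⟨m, hm, h⟩ := exists_ratio_hasDerivAt_eq_ratio_slope stdNormalPDF
    (fun x => -x * stdNormalPDF x) huv continuous_stdNormalPDF.continuousOn
    (fun x _ => hasDerivAt_stdNormalPDF x) stdNormalCDF stdNormalPDF
    (fun x _ => (hasDerivAt_stdNormalCDF x).continuousAt.continuousWithinAt)
    (fun x _ => hasDerivAt_stdNormalCDF x)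
  refine ⟨m, hm, mul_right_cancel₀ (stdNormalPDF_pos m).ne' ?_⟩
  linarith

/-- An antiderivative of `(t - m)² φ(t)` is monotone. -/
theorem monotone_stdNormal_second_moment (m : ℝ) :
    Monotone fun t => (1 + m ^ 2) * stdNormalCDF t + (2 * m - t) * stdNormalPDF t := by
  refine monotone_of_hasDerivAt_nonneg (f' := fun t => (t - m) ^ 2 * stdNormalPDF t)
    (fun t => ?_) fun t => mul_nonneg (sq_nonneg _) (stdNormalPDF_pos t).le
  refine (((hasDerivAt_stdNormalCDF t).const_mul (1 + m ^ 2)).add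
    (((hasDerivAt_id t).const_sub (2 * m)).mul (hasDerivAt_stdNormalPDF t))).congr_deriv ?_
  simp only [id]
  ring

theorem stdNormal_truncated_variance_bounds {u v : ℝ} (huv : u < v) :
    0 ≤ (v * stdNormalPDF v - u * stdNormalPDF u) * (stdNormalCDF v - stdNormalCDF u)
        + (stdNormalPDF v - stdNormalPDF u) ^ 2 ∧
      (v * stdNormalPDF v - u * stdNormalPDF u) * (stdNormalCDF v - stdNormalCDF u)
        + (stdNormalPDF v - stdNormalPDF u) ^ 2 ≤ (stdNormalCDF v - stdNormalCDF u) ^ 2 := by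
  obtain ⟨m, ⟨hum, hmv⟩, hm⟩ := exists_stdNormalPDF_sub_eq_mul huv
  have hZ : 0 < stdNormalCDF v - stdNormalCDF u := sub_pos.2 (strictMono_stdNormalCDF huv)
  have hmono := monotone_stdNormal_second_moment m huv.le
  simp only at hmono
  set Z := stdNormalCDF v - stdNormalCDF u with hZdef
  have hsq : (stdNormalPDF v - stdNormalPDF u) ^ 2
      = m * (stdNormalPDF u - stdNormalPDF v) * Z := by
    linear_combination (stdNormalPDF u - stdNormalPDF v) * hm
  constructor
  · have hu := mul_nonneg (sub_nonneg.2 hum.le) (stdNormalPDF_pos u).le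
    have hv := mul_nonneg (sub_nonneg.2 hmv.le) (stdNormalPDF_pos v).le
    rw [hsq]
    linarith [mul_nonneg (add_nonneg hu hv) hZ.le]
  · have hmZ : m * (stdNormalPDF u - stdNormalPDF v) = m ^ 2 * Z := by
      rw [hm]
      ring
    have h : 0 ≤ Z - (v * stdNormalPDF v - u * stdNormalPDF u)
        - m * (stdNormalPDF u - stdNormalPDF v) := by
      have hexp : (1 + m ^ 2) * Z
          = (1 + m ^ 2) * stdNormalCDF v - (1 + m ^ 2) * stdNormalCDF u := by
        rw [hZdef]
        ring
      linarith
    rw [hsq]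
    linarith [mul_nonneg h hZ.le]

/-- Hessian bound for the per-entry Probit loss
`h(x) = −log(Φ((b − x)/σ) − Φ((a − x)/σ))`: `0 ≤ h''(x) ≤ 1/σ²` for every `x`. -/
theorem probit_neg_log_likelihood_second_deriv_bound (σ a b : ℝ) (hσ : 0 < σ) (hab : a < b)
    (x : ℝ) :
    0 ≤ deriv (deriv
        (fun x : ℝ => -Real.log (stdNormalCDF ((b - x) / σ) - stdNormalCDF ((a - x) / σ)))) x ∧
      deriv (deriv
        (fun x : ℝ => -Real.log (stdNormalCDF ((b - x) / σ) - stdNormalCDF ((a - x) / σ)))) x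
        ≤ 1 / σ ^ 2 := by
  have hlt (y : ℝ) : (a - y) / σ < (b - y) / σ := by gcongr
  have hpos (y : ℝ) : 0 < stdNormalCDF ((b - y) / σ) - stdNormalCDF ((a - y) / σ) :=
    sub_pos.2 (strictMono_stdNormalCDF (hlt y))
  have haff (c y : ℝ) : HasDerivAt (fun y => (c - y) / σ) (-1 / σ) y :=
    ((hasDerivAt_id y).const_sub c).div_const σ
  have hcdf (y : ℝ) : HasDerivAt
      (fun y => stdNormalCDF ((b - y) / σ) - stdNormalCDF ((a - y) / σ))
      (stdNormalPDF ((b - y) / σ) * (-1 / σ) - stdNormalPDF ((a - y) / σ) * (-1 / σ)) y :=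
    ((hasDerivAt_stdNormalCDF _).comp y (haff b y)).sub
      ((hasDerivAt_stdNormalCDF _).comp y (haff a y))
  have hpdf (y : ℝ) : HasDerivAt
      (fun y => stdNormalPDF ((b - y) / σ) - stdNormalPDF ((a - y) / σ))
      (-((b - y) / σ) * stdNormalPDF ((b - y) / σ) * (-1 / σ)
        - -((a - y) / σ) * stdNormalPDF ((a - y) / σ) * (-1 / σ)) y :=
    ((hasDerivAt_stdNormalPDF _).comp y (haff b y)).sub
      ((hasDerivAt_stdNormalPDF _).comp y (haff a y))
  have hderiv : deriv
      (fun x : ℝ => -Real.log (stdNormalCDF ((b - x) / σ) - stdNormalCDF ((a - x) / σ)))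
      = fun y => (stdNormalPDF ((b - y) / σ) - stdNormalPDF ((a - y) / σ)) /
        (stdNormalCDF ((b - y) / σ) - stdNormalCDF ((a - y) / σ)) / σ := by
    ext y
    rw [((hcdf y).log (hpos y).ne').fun_neg.deriv]
    ring
  have hZ := hpos x
  obtain ⟨hlower, hupper⟩ := stdNormal_truncated_variance_bounds (hlt x)
  rw [hderiv, (((hpdf x).fun_div (hcdf x) hZ.ne').div_const σ).deriv]
  generalize (b - x) / σ = v at *
  generalize (a - x) / σ = u at *
  have heq : ((-v * stdNormalPDF v * (-1 / σ) - -u * stdNormalPDF u * (-1 / σ))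
        * (stdNormalCDF v - stdNormalCDF u)
      - (stdNormalPDF v - stdNormalPDF u)
        * (stdNormalPDF v * (-1 / σ) - stdNormalPDF u * (-1 / σ)))
        / (stdNormalCDF v - stdNormalCDF u) ^ 2 / σ
      = ((v * stdNormalPDF v - u * stdNormalPDF u) * (stdNormalCDF v - stdNormalCDF u)
        + (stdNormalPDF v - stdNormalPDF u) ^ 2)
        / (stdNormalCDF v - stdNormalCDF u) ^ 2 / σ ^ 2 := by
    ring
  rw [heq]
  refine ⟨by positivity, ?_⟩
  gcongr
  exact div_le_one_of_le₀ hupper (sq_nonneg _)
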